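/- arXiv:1903.09383 — 5 statements merged into one kernel-verified Lean document; each statement's English description precedes it below -/
import Mathlib

section
/- Let f : ℝ^p → ℝ be continuous and coercive (f(x) → ∞ as ‖x‖ → ∞) with a unique global minimizer x*. Let D : ℝ^p → ℝ^p be a continuous update map with D(x*) = x* such that f(β·D(x) + (1−β)·x) < f(x) for every β ∈ (0,1] and every x ≠ x*. Then for every starting point x₀ ∈ ℝ^p, the sequence defined by x_{n+1} = D(x_n) converges to x*. -/
open scoped RealInnerProductSpace

/-- Global convergence of an update map that strictly decreases a continuous,
coercive function with a unique global minimizer along every update segment. -/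
theorem stmt_0 (p : ℕ)
    (f : EuclideanSpace ℝ (Fin p) → ℝ)
    (hf : Continuous f)
    (hcoer : Filter.Tendsto f (Filter.comap norm Filter.atTop) Filter.atTop)
    (xstar : EuclideanSpace ℝ (Fin p))
    (hmin : ∀ x, x ≠ xstar → f xstar < f x)
    (D : EuclideanSpace ℝ (Fin p) → EuclideanSpace ℝ (Fin p))
    (hD : Continuous D) (hDfix : D xstar = xstar)
    (hdec : ∀ x, x ≠ xstar → ∀ β : ℝ, β ∈ Set.Ioc (0 : ℝ) 1 →
      f (β • D x + (1 - β) • x) < f x)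
    (x0 : EuclideanSpace ℝ (Fin p))
    (x : ℕ → EuclideanSpace ℝ (Fin p))
    (hx0 : x 0 = x0) (hxs : ∀ n, x (n + 1) = D (x n)) :
    Filter.Tendsto x Filter.atTop (nhds xstar) := by
  have hstep : ∀ y, f (D y) ≤ f y := by
    intro y
    by_cases hy : y = xstar
    · rw [hy, hDfix]
    · have h := hdec y hy 1 ⟨one_pos, le_refl 1⟩
      simp only [one_smul, sub_self, zero_smul, add_zero] at h
      exact h.le
  have hanti : Antitone (fun n => f (x n)) := by
    refine antitone_nat_of_succ_le fun n => ?_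
    rw [hxs]
    exact hstep (x n)
  have hbdd : BddBelow (Set.range fun n => f (x n)) := by
    refine ⟨f xstar, ?_⟩
    rintro _ ⟨n, rfl⟩
    by_cases hy : x n = xstar
    · simp [hy]
    · exact (hmin _ hy).le
  have hL := tendsto_atTop_ciInf hanti hbdd
  set L := ⨅ n, f (x n)
  have hK : IsCompact {y | f y ≤ f (x 0)} := by
    refine Metric.isCompact_of_isClosed_isBounded (isClosed_le hf continuous_const) ?_
    rw [comap_norm_atTop] at hcoer
    have h := hcoer.eventually (Filter.eventually_gt_atTop (f (x 0)))
    rw [← Bornology.isCobounded_compl_iff]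
    refine Filter.mem_of_superset h ?_
    intro y hy hy'
    exact (lt_of_lt_of_le (show f (x 0) < f y from hy) hy').false
  refine hK.tendsto_nhds_of_unique_mapClusterPt
    (Filter.Eventually.of_forall fun n => hanti (Nat.zero_le n)) ?_
  intro y _ hy
  obtain ⟨φ, hφ, hlim⟩ := MapClusterPt.tendsto_subseq hy
  have h1 : f y = L :=
    tendsto_nhds_unique ((hf.tendsto y).comp hlim) (hL.comp hφ.tendsto_atTop)
  have h2 : f (D y) = L := by
    refine tendsto_nhds_unique (((hf.comp hD).tendsto y).comp hlim) ?_
    refine Filter.Tendsto.congr ?_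
      ((hL.comp (Filter.tendsto_add_atTop_nat 1)).comp hφ.tendsto_atTop)
    intro n
    simp [hxs]
  by_contra hne
  have h := hdec y hne 1 ⟨one_pos, le_refl 1⟩
  simp only [one_smul, sub_self, zero_smul, add_zero] at h
  linarith
end

section
/- Let f : ℝ^p → ℝ be differentiable on an open set containing x with gradient ∇f continuous at x. If x is an NN-GPP of f, i.e. there exists r > 0 such that ∇f(x + λu)·u ≥ 0 for every unit vector u ∈ ℝ^p and every λ ∈ (0, r], then ∇f(x) = 0. -/
open scoped RealInnerProductSpace

/-- An NN-GPP of a function that is differentiable near the point, with gradient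
continuous at the point, is a critical point. -/
theorem stmt_4 (p : ℕ)
    (f : EuclideanSpace ℝ (Fin p) → ℝ)
    (x : EuclideanSpace ℝ (Fin p))
    (U : Set (EuclideanSpace ℝ (Fin p)))
    (hU : IsOpen U) (hxU : x ∈ U)
    (hdiff : ∀ y ∈ U, DifferentiableAt ℝ f y)
    (hgradcont : ContinuousAt (gradient f) x)
    (hnngpp : ∃ r > (0 : ℝ), ∀ u : EuclideanSpace ℝ (Fin p), ‖u‖ = 1 →
      ∀ l ∈ Set.Ioc (0 : ℝ) r, 0 ≤ ⟪gradient f (x + l • u), u⟫) :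
    gradient f x = 0 := by
  obtain ⟨r, hr, h⟩ := hnngpp
  have key : ∀ u : EuclideanSpace ℝ (Fin p), ‖u‖ = 1 → 0 ≤ ⟪gradient f x, u⟫ := by
    intro u hu
    have h1 : Filter.Tendsto (fun l : ℝ => x + l • u) (nhdsWithin 0 (Set.Ioi 0)) (nhds x) := by
      have hc : Continuous (fun l : ℝ => x + l • u) := by fun_prop
      have h0 := hc.tendsto 0
      simp only [zero_smul, add_zero] at h0
      exact h0.mono_left nhdsWithin_le_nhds
    have h2 : Filter.Tendsto (fun l : ℝ => ⟪gradient f (x + l • u), u⟫)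
        (nhdsWithin 0 (Set.Ioi 0)) (nhds ⟪gradient f x, u⟫) :=
      (hgradcont.tendsto.comp h1).inner tendsto_const_nhds
    refine ge_of_tendsto h2 ?_
    filter_upwards [Ioc_mem_nhdsGT hr] with l hl using h u hu l hl
  by_contra hg
  have hn : 0 < ‖gradient f x‖ := norm_pos_iff.mpr hg
  have h3 := key (-(‖gradient f x‖⁻¹ • gradient f x)) (by
    rw [norm_neg, norm_smul, norm_inv, norm_norm, inv_mul_cancel₀ hn.ne'])
  rw [inner_neg_right, real_inner_smul_right, real_inner_self_eq_norm_sq] at h3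
  have h4 : 0 < ‖gradient f x‖⁻¹ * ‖gradient f x‖ ^ 2 := by positivity
  linarith
end

section
/- Let f : ℝ^p → ℝ be differentiable, let x* ∈ ℝ^p and ε > 0, and suppose f is directional-derivative coercive around the ε-ball at x*, i.e. ∇f(x₁)·(x₁ − x₂) > 0 for every x₁ with ‖x₁ − x*‖ ≥ ε and every x₂ with ‖x₂ − x*‖ < ε. Then no point x with ‖x − x*‖ > ε is an NN-GPP of f: for every r > 0 there exist a unit vector u and λ ∈ (0, r] with ∇f(x + λu)·u < 0. -/
open scoped RealInnerProductSpace

/-- Under directional-derivative coercivity around an ε-ball, no point strictly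
outside the ball is an NN-GPP. -/
theorem stmt_8 (p : ℕ)
    (f : EuclideanSpace ℝ (Fin p) → ℝ)
    (hdiff : Differentiable ℝ f)
    (xstar : EuclideanSpace ℝ (Fin p))
    (ε : ℝ) (hε : 0 < ε)
    (hcoer : ∀ x₁ x₂ : EuclideanSpace ℝ (Fin p), ε ≤ ‖x₁ - xstar‖ →
      ‖x₂ - xstar‖ < ε → 0 < ⟪gradient f x₁, x₁ - x₂⟫) :
    ∀ x : EuclideanSpace ℝ (Fin p), ε < ‖x - xstar‖ →
      ∀ r > (0 : ℝ), ∃ u : EuclideanSpace ℝ (Fin p), ‖u‖ = 1 ∧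
        ∃ l ∈ Set.Ioc (0 : ℝ) r, ⟪gradient f (x + l • u), u⟫ < 0 := by
  intro x hx r hr
  set d := ‖x - xstar‖ with hd
  have hd0 : 0 < d := hε.trans hx
  set l := min r (d - ε) with hl
  have hl0 : 0 < l := lt_min hr (by linarith)
  have hld : l ≤ d - ε := min_le_right _ _
  have hc : 0 < 1 - l * d⁻¹ := by
    have : l * d⁻¹ < 1 := by
      rw [← div_eq_mul_inv, div_lt_one hd0]; linarith
    linarith
  refine ⟨(-d⁻¹) • (x - xstar), ?_, l, ⟨hl0, min_le_left _ _⟩, ?_⟩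
  · rw [norm_smul, norm_neg, norm_inv, Real.norm_of_nonneg hd0.le, ← hd]
    exact inv_mul_cancel₀ hd0.ne'
  · have key : x + l • ((-d⁻¹) • (x - xstar)) - xstar = (1 - l * d⁻¹) • (x - xstar) := by
      module
    have h := hcoer (x + l • ((-d⁻¹) • (x - xstar))) xstar (by
      rw [key, norm_smul, Real.norm_of_nonneg hc.le, ← hd, sub_mul, mul_assoc,
        inv_mul_cancel₀ hd0.ne']
      linarith) (by simpa using hε)
    rw [key, inner_smul_right] at h
    have h2 := pos_of_mul_pos_right h hc.le
    rw [inner_smul_right]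
    have : 0 < d⁻¹ := inv_pos.mpr hd0
    have := mul_pos this h2
    linarith
end

section
/- Let f : ℝ^p → ℝ be differentiable, let x* ∈ ℝ^p and ε > 0, and suppose f is directional-derivative coercive around the ε-ball at x*, i.e. ∇f(x₁)·(x₁ − x₂) > 0 for every x₁ with ‖x₁ − x*‖ ≥ ε and every x₂ with ‖x₂ − x*‖ < ε. Let x satisfy ‖x − x*‖ < ε, let d ∈ ℝ^p, and let α* > 0 be such that ∇f(x + αd)·d < 0 for all α ∈ [0, α*). Then ‖x + αd − x*‖ < ε for all α ∈ [0, α*), and ‖x + α*d − x*‖ ≤ ε. -/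
open scoped RealInnerProductSpace

/-- Invariance of the ε-ball under line-search updates accepted at the first
sign change of the directional derivative. -/
theorem stmt_9 (p : ℕ)
    (f : EuclideanSpace ℝ (Fin p) → ℝ)
    (hdiff : Differentiable ℝ f)
    (xstar : EuclideanSpace ℝ (Fin p))
    (ε : ℝ) (hε : 0 < ε)
    (hcoer : ∀ x₁ x₂ : EuclideanSpace ℝ (Fin p), ε ≤ ‖x₁ - xstar‖ →
      ‖x₂ - xstar‖ < ε → 0 < ⟪gradient f x₁, x₁ - x₂⟫)
    (x d : EuclideanSpace ℝ (Fin p))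
    (hx : ‖x - xstar‖ < ε)
    (αstar : ℝ) (hαstar : 0 < αstar)
    (hneg : ∀ α ∈ Set.Ico (0 : ℝ) αstar, ⟪gradient f (x + α • d), d⟫ < 0) :
    (∀ α ∈ Set.Ico (0 : ℝ) αstar, ‖x + α • d - xstar‖ < ε) ∧
    ‖x + αstar • d - xstar‖ ≤ ε := by
  have h1 : ∀ α ∈ Set.Ico (0 : ℝ) αstar, ‖x + α • d - xstar‖ < ε := by
    intro α hα
    by_contra hcon
    have h := hcoer (x + α • d) x (not_lt.mp hcon) hx
    rw [add_sub_cancel_left, inner_smul_right] at h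
    have h2 := hneg α hα
    have h3 := hα.1
    nlinarith
  refine ⟨h1, ?_⟩
  have hcl : IsClosed {α : ℝ | ‖x + α • d - xstar‖ ≤ ε} :=
    isClosed_le (by fun_prop) continuous_const
  have hsub : closure (Set.Ico (0 : ℝ) αstar) ⊆ {α : ℝ | ‖x + α • d - xstar‖ ≤ ε} :=
    closure_minimal (fun α hα => (h1 α hα).le) hcl
  rw [closure_Ico hαstar.ne] at hsub
  exact hsub (Set.right_mem_Icc.mpr hαstar.le)
end

section
/- Let f : ℝ^p → ℝ be continuously differentiable and coercive (f(x) → ∞ as ‖x‖ → ∞), let x ∈ ℝ^p and let d ∈ ℝ^p be a descent direction at x, i.e. ∇f(x)·d < 0. Then there exists α* > 0 such that ∇f(x + α*d)·d = 0, ∇f(x + αd)·d < 0 for all α ∈ [0, α*), and f(x + βα*d) < f(x) for all β ∈ (0,1]. -/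
open scoped RealInnerProductSpace

/-- Along a descent direction of a continuously differentiable coercive
function there is a first sign change of the directional derivative, and
accepting that step size strictly decreases the function at every intermediate
point of the update segment. -/
theorem stmt_13 (p : ℕ)
    (f : EuclideanSpace ℝ (Fin p) → ℝ)
    (hf : ContDiff ℝ 1 f)
    (hcoer : Filter.Tendsto f (Filter.comap norm Filter.atTop) Filter.atTop)
    (x d : EuclideanSpace ℝ (Fin p))
    (hdesc : ⟪gradient f x, d⟫ < 0) :
    ∃ αstar > (0 : ℝ),
      ⟪gradient f (x + αstar • d), d⟫ = 0 ∧
      (∀ α ∈ Set.Ico (0 : ℝ) αstar, ⟪gradient f (x + α • d), d⟫ < 0) ∧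
      (∀ β ∈ Set.Ioc (0 : ℝ) 1, f (x + (β * αstar) • d) < f x) := by
  have hd : d ≠ 0 := by
    rintro rfl
    simp at hdesc
  have hgf : ∀ y, ⟪gradient f y, d⟫ = fderiv ℝ f y d := by
    intro y
    unfold gradient
    exact InnerProductSpace.toDual_symm_apply
  have hx0 : x = x + (0 : ℝ) • d := by simp
  rw [hx0] at hdesc
  simp only [hgf] at hdesc ⊢
  have hline : Continuous (fun α : ℝ => x + α • d) := by fun_prop
  obtain ⟨g, hg⟩ : ∃ g : ℝ → ℝ, g = fun α => fderiv ℝ f (x + α • d) d := ⟨_, rfl⟩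
  have hgα : ∀ α : ℝ, fderiv ℝ f (x + α • d) d = g α := fun α => by rw [hg]
  have hgc : Continuous g := by
    rw [hg]
    exact ((hf.continuous_fderiv one_ne_zero).comp hline).clm_apply continuous_const
  have hder : ∀ α : ℝ, HasDerivAt (fun α : ℝ => f (x + α • d)) (g α) α := by
    intro α
    have h1 : HasFDerivAt f (fderiv ℝ f (x + α • d)) (x + α • d) :=
      ((hf.differentiable one_ne_zero) _).hasFDerivAt
    have h2 : HasDerivAt (fun α : ℝ => x + α • d) d α := by
      simpa using ((hasDerivAt_id α).smul_const d).const_add x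
    rw [← hgα]
    exact h1.comp_hasDerivAt α h2
  have hφc : Continuous (fun α : ℝ => f (x + α • d)) := hf.continuous.comp hline
  simp only [hgα] at hdesc ⊢
  have hdec : ∀ b : ℝ, (∀ α ∈ Set.Ico (0 : ℝ) b, g α < 0) →
      StrictAntiOn (fun α : ℝ => f (x + α • d)) (Set.Icc 0 b) := by
    intro b hb
    refine strictAntiOn_of_deriv_neg (convex_Icc 0 b) hφc.continuousOn ?_
    intro α hα
    rw [interior_Icc] at hα
    rw [(hder α).deriv]
    exact hb α ⟨hα.1.le, hα.2⟩
  have hne : ∃ α : ℝ, 0 ≤ α ∧ 0 ≤ g α := by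
    by_contra! hcon
    have htend : Filter.Tendsto (fun α : ℝ => f (x + α • d)) Filter.atTop Filter.atTop := by
      refine hcoer.comp (Filter.tendsto_comap_iff.2 ?_)
      have h3 : Filter.Tendsto (fun α : ℝ => α * ‖d‖ - ‖x‖) Filter.atTop Filter.atTop :=
        Filter.tendsto_atTop_add_const_right _ _
          (Filter.tendsto_id.atTop_mul_const (norm_pos_iff.2 hd))
      refine Filter.tendsto_atTop_mono (fun α => ?_) h3
      have h4 : ‖α • d‖ ≤ ‖x + α • d‖ + ‖x‖ := by
        have := norm_sub_le (x + α • d) x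
        simpa using this
      have h5 : α * ‖d‖ ≤ ‖α • d‖ := by
        rw [norm_smul]
        exact mul_le_mul_of_nonneg_right (le_abs_self α) (norm_nonneg d)
      simp only [Function.comp]
      linarith
    obtain ⟨b, hb1, hb2⟩ := ((htend.eventually_ge_atTop (f (x + (0 : ℝ) • d))).and
      (Filter.eventually_gt_atTop 0)).exists
    have := hdec b (fun α hα => hcon α hα.1) (Set.left_mem_Icc.2 hb2.le)
      (Set.right_mem_Icc.2 hb2.le) hb2
    exact absurd hb1 (not_le.2 this)
  have hScl : IsClosed {α : ℝ | 0 ≤ α ∧ 0 ≤ g α} :=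
    (isClosed_le continuous_const continuous_id).inter (isClosed_le continuous_const hgc)
  have hSbd : BddBelow {α : ℝ | 0 ≤ α ∧ 0 ≤ g α} := ⟨0, fun α hα => hα.1⟩
  obtain ⟨a, ha⟩ : ∃ a, a = sInf {α : ℝ | 0 ≤ α ∧ 0 ≤ g α} := ⟨_, rfl⟩
  have haS : 0 ≤ a ∧ 0 ≤ g a := by
    rw [ha]
    exact hScl.csInf_mem hne hSbd
  have hlt : ∀ α ∈ Set.Ico (0 : ℝ) a, g α < 0 := by
    intro α hα
    by_contra! h
    have : a ≤ α := by
      rw [ha]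
      exact csInf_le hSbd ⟨hα.1, h⟩
    exact absurd hα.2 (not_lt.2 this)
  have ha0 : 0 < a := by
    refine lt_of_le_of_ne haS.1 ?_
    rintro h
    rw [← h] at haS
    exact absurd hdesc (not_lt.2 haS.2)
  refine ⟨a, ha0, le_antisymm ?_ haS.2, hlt, ?_⟩
  · by_contra! h
    obtain ⟨c, hc, hc0⟩ := intermediate_value_Icc haS.1 hgc.continuousOn
      (show (0 : ℝ) ∈ Set.Icc (g 0) (g a) from ⟨hdesc.le, h.le⟩)
    rcases lt_or_eq_of_le hc.2 with h1 | h1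
    · exact absurd (hlt c ⟨hc.1, h1⟩) (by rw [hc0]; exact lt_irrefl 0)
    · rw [h1] at hc0
      exact absurd h (by rw [hc0]; exact lt_irrefl 0)
  · intro β hβ
    have hpos : 0 < β * a := mul_pos hβ.1 ha0
    have hle : β * a ≤ a := mul_le_of_le_one_left ha0.le hβ.2
    have := hdec a hlt (Set.left_mem_Icc.2 ha0.le) ⟨hpos.le, hle⟩ hpos
    simpa using this
end
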